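/- For every 1 ≤ p ≤ n−1 and every (k_1,…,k_n) ∈ [1,r]^n, in H_{n,r} one has T_p·b_{k_1,…,k_p,k_{p+1},…,k_n} − b_{k_1,…,k_{p+1},k_p,…,k_n}·T_p = (q − q^{−1})·( [k_p < k_{p+1}]·b_{k_1,…,k_p,k_{p+1},…,k_n} − [k_p > k_{p+1}]·b_{k_1,…,k_{p+1},k_p,…,k_n} ), where [P] is 1 if P holds and 0 otherwise. -/

import Mathlib

open Polynomial

namespace MAK

noncomputable section

variable (R : Type*) [CommRing R] (n r : ℕ) (q Δ : Rˣ) (u : Fin r → R) (F : Fin r → R[X])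

/-- The free `R`-algebra on generators `t_1, …, t_n` (left) and `T_1, …, T_{n-1}` (right). -/
abbrev FA := FreeAlgebra R (Fin n ⊕ Fin (n - 1))

/-- The generators `t_i`. -/
def tf (i : Fin n) : FA R n := FreeAlgebra.ι R (Sum.inl i)

/-- The generators `T_j`. -/
def Tf (j : Fin (n - 1)) : FA R n := FreeAlgebra.ι R (Sum.inr j)

/-- The index `j`, viewed in `Fin n`. -/
def lo (j : Fin (n - 1)) : Fin n := ⟨j.1, by have := j.2; omega⟩

/-- The index `j + 1`, viewed in `Fin n`. -/
def hi (j : Fin (n - 1)) : Fin n := ⟨j.1 + 1, by have := j.2; omega⟩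

/-- The element `B_j = Δ⁻² Σ_{c1<c2} (u_{c2} - u_{c1})(q - q⁻¹) F_{c1}(t_j) F_{c2}(t_{j+1})`. -/
def Bel (j : Fin (n - 1)) : FA R n :=
  ∑ c2 : Fin r, ∑ c1 ∈ Finset.univ.filter (fun c1 => c1 < c2),
    (((Δ⁻¹ : Rˣ) : R) ^ 2 * ((u c2 - u c1) * ((q : R) - ((q⁻¹ : Rˣ) : R)))) •
      (aeval (tf R n (lo n j)) (F c1) * aeval (tf R n (hi n j)) (F c2))

/-- The defining relations of the modified Ariki-Koike algebra. -/
inductive Rel : FA R n → FA R n → Prop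
  | quad (j : Fin (n - 1)) :
      Rel ((Tf R n j - algebraMap R (FA R n) (q : R)) *
        (Tf R n j + algebraMap R (FA R n) ((q⁻¹ : Rˣ) : R))) 0
  | tord (i : Fin n) : Rel (aeval (tf R n i) (∏ c : Fin r, (X - C (u c)))) 0
  | braid (j k : Fin (n - 1)) (h : k.1 = j.1 + 1) :
      Rel (Tf R n j * Tf R n k * Tf R n j) (Tf R n k * Tf R n j * Tf R n k)
  | Tcomm (j k : Fin (n - 1)) (h : j.1 + 2 ≤ k.1 ∨ k.1 + 2 ≤ j.1) :
      Rel (Tf R n j * Tf R n k) (Tf R n k * Tf R n j)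
  | tcomm (i i' : Fin n) : Rel (tf R n i * tf R n i') (tf R n i' * tf R n i)
  | Tt (j : Fin (n - 1)) (i : Fin n) (h1 : i ≠ lo n j) (h2 : i ≠ hi n j) :
      Rel (Tf R n j * tf R n i) (tf R n i * Tf R n j)
  | Thi (j : Fin (n - 1)) :
      Rel (Tf R n j * tf R n (hi n j)) (tf R n (lo n j) * Tf R n j + Bel R n r q Δ u F j)
  | Tlo (j : Fin (n - 1)) :
      Rel (Tf R n j * tf R n (lo n j)) (tf R n (hi n j) * Tf R n j - Bel R n r q Δ u F j)

/-- The modified Ariki-Koike algebra `H_{n,r}(R, q, u_1, …, u_r)`. -/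
abbrev Hnr := RingQuot (Rel R n r q Δ u F)

/-- The canonical projection. -/
def pim : FA R n →ₐ[R] Hnr R n r q Δ u F := RingQuot.mkAlgHom R (Rel R n r q Δ u F)

/-- The generator `t_i` of `H_{n,r}`. -/
def tt (i : Fin n) : Hnr R n r q Δ u F := pim R n r q Δ u F (tf R n i)

/-- The generator `T_j` of `H_{n,r}`. -/
def TT (j : Fin (n - 1)) : Hnr R n r q Δ u F := pim R n r q Δ u F (Tf R n j)

/-- The Lagrange basis polynomial `∏_{j ≠ c} (X - u_j)/(u_c - u_j)`. -/
def bpoly (c : Fin r) : R[X] :=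
  ∏ j ∈ Finset.univ.filter (fun j => j ≠ c), Ring.inverse (u c - u j) • (X - C (u j))

/-- The idempotent `b_{k_1, …, k_n}`. -/
def b (k : Fin n → Fin r) : Hnr R n r q Δ u F :=
  (List.ofFn fun i : Fin n => aeval (tt R n r q Δ u F i) (bpoly R r u (k i))).prod

/-- The element `B'_{i,j} = -(q - q⁻¹) Σ_{k_i < k_j} b_{k_1, …, k_n}`. -/
def B' (i j : Fin n) : Hnr R n r q Δ u F :=
  -(((q : R) - ((q⁻¹ : Rˣ) : R)) •
    ∑ k ∈ Finset.univ.filter (fun k : Fin n → Fin r => k i < k j), b R n r q Δ u F k)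

/-- The element `g_i := T_i + B'_{i,i+1}`. -/
def g (j : Fin (n - 1)) : Hnr R n r q Δ u F :=
  TT R n r q Δ u F j + B' R n r q Δ u F (lo n j) (hi n j)

/-- The idempotent `e_{i,j} = Σ_{k_i = k_j} b_{k_1, …, k_n}`. -/
def eij (i j : Fin n) : Hnr R n r q Δ u F :=
  ∑ k ∈ Finset.univ.filter (fun k : Fin n → Fin r => k i = k j), b R n r q Δ u F k

/-- The idempotent `e_i = e_{i,i+1}`. -/
def ee (j : Fin (n - 1)) : Hnr R n r q Δ u F := eij R n r q Δ u F (lo n j) (hi n j)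

/-- The simple transposition `s_j = (j, j+1)` in `S_n`. -/
def simple (j : Fin (n - 1)) : Equiv.Perm (Fin n) := Equiv.swap (lo n j) (hi n j)

/-- `l` is a reduced word for the permutation `w`. -/
def IsReducedWord (w : Equiv.Perm (Fin n)) (l : List (Fin (n - 1))) : Prop :=
  (l.map (simple n)).prod = w ∧
    ∀ l' : List (Fin (n - 1)), (l'.map (simple n)).prod = w → l.length ≤ l'.length

/-- The element `g_w = g_{i_1} ⋯ g_{i_l}` associated to a word `l = (i_1, …, i_l)`. -/
def gword (l : List (Fin (n - 1))) : Hnr R n r q Δ u F := (l.map (g R n r q Δ u F)).prod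

/-- The element `T_w = T_{i_1} ⋯ T_{i_l}` associated to a word `l = (i_1, …, i_l)`. -/
def Tword (l : List (Fin (n - 1))) : Hnr R n r q Δ u F := (l.map (TT R n r q Δ u F)).prod

/-- The monomial `t_1^{c_1} ⋯ t_n^{c_n}`. -/
def tmon (c : Fin n → ℕ) : Hnr R n r q Δ u F :=
  (List.ofFn fun i : Fin n => tt R n r q Δ u F i ^ c i).prod

end

end MAK

open MAK


namespace MAK

section ListProd

variable {R A : Type*} [CommRing R] [Ring A] [Algebra R A]

/-- An element commuting with all factors of a product and acting on one of them by a scalar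
acts on the product by that scalar. -/
lemma mul_list_prod_eq_smul {x : A} {c : R} {l : List A} (hcomm : ∀ a ∈ l, Commute x a)
    {a : A} (ha : a ∈ l) (hxa : x * a = c • a) : x * l.prod = c • l.prod := by
  induction l with
  | nil => simp at ha
  | cons y l ih =>
    rw [List.prod_cons]
    rcases List.mem_cons.1 ha with rfl | h
    · rw [← mul_assoc, hxa, smul_mul_assoc]
    · rw [← mul_assoc, (hcomm y (by simp)).eq, mul_assoc,
        ih (fun z hz => hcomm z (List.mem_cons_of_mem _ hz)) h, mul_smul_comm]

/-- Noncommutative distributivity of an ordered product over sums. -/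
lemma sum_list_prod_ofFn {r : ℕ} (n : ℕ) (f : Fin n → Fin r → A) :
    ∑ k : Fin n → Fin r, (List.ofFn fun i => f i (k i)).prod =
      (List.ofFn fun i => ∑ c, f i c).prod := by
  induction n with
  | zero => simp
  | succ n ih =>
    rw [← (Fin.consEquiv fun _ => Fin r).sum_comp, Fintype.sum_prod_type]
    simp only [Fin.consEquiv_apply, List.ofFn_succ, List.prod_cons, Fin.cons_zero, Fin.cons_succ]
    simp only [← Finset.mul_sum, ih, ← Finset.sum_mul]

/-- A polynomial in `x` acts on an eigenvector of `x` by its value at the eigenvalue. -/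
lemma aeval_mul_eq_eval_smul {x v : A} {c : R} (h : x * v = c • v) (P : R[X]) :
    aeval x P * v = P.eval c • v := by
  induction P using Polynomial.induction_on' with
  | add P Q hP hQ => simp [add_mul, add_smul, hP, hQ]
  | monomial m a =>
    have hpow : x ^ m * v = c ^ m • v := by
      induction m with
      | zero => simp
      | succ m ih => rw [pow_succ, mul_assoc, h, mul_smul_comm, ih, smul_smul, pow_succ, mul_comm]
    rw [aeval_monomial, eval_monomial, mul_assoc, hpow, ← Algebra.smul_def, smul_smul]

end ListProd

section Weight

variable {R A : Type*} [CommRing R] [Ring A] [Algebra R A] {n r : ℕ} {u : Fin r → R}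
  {t : Fin n → A} {e : (Fin n → Fin r) → A}

lemma weight_mul_weight_of_ne (hu : ∀ c c', c ≠ c' → IsUnit (u c - u c'))
    (hl : ∀ k i, t i * e k = u (k i) • e k) (hr : ∀ k i, e k * t i = u (k i) • e k)
    {k l : Fin n → Fin r} (h : l ≠ k) : e l * e k = 0 := by
  obtain ⟨i, hi⟩ := Function.ne_iff.1 h
  have h1 : e l * t i * e k = e l * (t i * e k) := mul_assoc _ _ _
  rw [hr, hl, smul_mul_assoc, mul_smul_comm] at h1
  rw [← (hu _ _ hi).smul_eq_zero, sub_smul, h1, sub_self]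

lemma weight_mul_self (hu : ∀ c c', c ≠ c' → IsUnit (u c - u c'))
    (hl : ∀ k i, t i * e k = u (k i) • e k) (hr : ∀ k i, e k * t i = u (k i) • e k)
    (hsum : ∑ k, e k = 1) (k : Fin n → Fin r) : e k * e k = e k := by
  have h : (∑ l, e l) * e k = e k := by rw [hsum, one_mul]
  rwa [Finset.sum_mul, Finset.sum_eq_single k
    (fun l _ h => weight_mul_weight_of_ne hu hl hr h) (by simp)] at h

/-- If `T` intertwines `t x` and `t y` up to an element `B` acting diagonally on the weight
idempotents `e k`, then it intertwines `e k` and its swap up to a diagonal correction. -/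
theorem mul_weight_sub_weight_mul (hu : ∀ c c', c ≠ c' → IsUnit (u c - u c'))
    (hl : ∀ k i, t i * e k = u (k i) • e k) (hr : ∀ k i, e k * t i = u (k i) • e k)
    (hsum : ∑ k, e k = 1) {x y : Fin n} {T B : A} {z : R}
    (hT : ∀ i, i ≠ x → i ≠ y → T * t i = t i * T)
    (hTx : T * t x = t y * T - B) (hTy : T * t y = t x * T + B)
    (hB : ∀ k, B * e k = (if k x < k y then (u (k y) - u (k x)) * z else 0) • e k)
    (k : Fin n → Fin r) :
    T * e k - e (fun i => k (Equiv.swap x y i)) * T =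
      z • ((if k x < k y then e k else 0) -
        (if k y < k x then e (fun i => k (Equiv.swap x y i)) else 0)) := by
  have horth : ∀ {k l}, l ≠ k → e l * e k = 0 := weight_mul_weight_of_ne hu hl hr
  have hout : ∀ k l i, i ≠ x → i ≠ y → (u (l i) - u (k i)) • (e l * T * e k) = 0 := by
    intro k l i h1 h2
    have h : e l * (T * t i) * e k = e l * (t i * T) * e k := by rw [hT i h1 h2]
    rw [mul_assoc, mul_assoc, hl, ← mul_assoc (e l) (t i), hr] at h
    simp only [mul_smul_comm, smul_mul_assoc, ← mul_assoc] at h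
    rw [sub_smul, h, sub_self]
  have hx : ∀ k l, (u (l y) - u (k x)) • (e l * T * e k) = e l * (B * e k) := by
    intro k l
    have h : e l * (T * t x) * e k = e l * (t y * T - B) * e k := by rw [hTx]
    rw [mul_assoc, mul_assoc, hl, mul_sub, ← mul_assoc (e l) (t y), hr, sub_mul,
      mul_assoc (e l) B] at h
    simp only [mul_smul_comm, smul_mul_assoc, ← mul_assoc] at h
    rw [sub_smul, h, mul_assoc (e l) B]
    simp [← mul_assoc]
  have hy : ∀ k l, (u (k y) - u (l x)) • (e l * T * e k) = e l * (B * e k) := by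
    intro k l
    have h : e l * (T * t y) * e k = e l * (t x * T + B) * e k := by rw [hTy]
    rw [mul_assoc, mul_assoc, hl, mul_add, ← mul_assoc (e l) (t x), hr, add_mul,
      mul_assoc (e l) B] at h
    simp only [mul_smul_comm, smul_mul_assoc, ← mul_assoc] at h
    rw [sub_smul, h, mul_assoc (e l) B]
    simp [← mul_assoc]
  have hzero : ∀ k l : Fin n → Fin r, l ≠ k → l ≠ (fun i => k (Equiv.swap x y i)) →
      e l * T * e k = 0 := by
    intro k l h1 h2
    have hB0 : e l * (B * e k) = 0 := by rw [hB, mul_smul_comm, horth h1, smul_zero]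
    obtain ⟨i, hi⟩ := Function.ne_iff.1 h2
    by_cases hix : i = x
    · subst hix
      rw [Equiv.swap_apply_left] at hi
      rw [← (hu _ _ hi.symm).smul_eq_zero, hy, hB0]
    by_cases hiy : i = y
    · subst hiy
      rw [Equiv.swap_apply_right] at hi
      rw [← (hu _ _ hi).smul_eq_zero, hx, hB0]
    rw [Equiv.swap_apply_of_ne_of_ne hix hiy] at hi
    rw [← (hu _ _ hi).smul_eq_zero, hout k l i hix hiy]
  have hdiag : ∀ k : Fin n → Fin r, k x ≠ k y →
      e k * T * e k = z • (if k x < k y then e k else 0) := by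
    intro k hk
    have hunit := hu _ _ hk.symm
    rw [← sub_eq_zero, ← hunit.smul_eq_zero, smul_sub, hx, hB, mul_smul_comm,
      weight_mul_self hu hl hr hsum]
    split_ifs <;> simp [smul_smul]
  have hleft : T * e k = ∑ l, e l * T * e k := by
    rw [← Finset.sum_mul, ← Finset.sum_mul, hsum, one_mul]
  have hright : ∀ l, e l * T = ∑ k, e l * T * e k := by
    intro l
    rw [← Finset.mul_sum, hsum, mul_one]
  have hswap : ∀ {k l : Fin n → Fin r}, k = (fun i => l (Equiv.swap x y i)) →
      l = fun i => k (Equiv.swap x y i) := by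
    rintro _ l rfl
    simp
  by_cases hk : k x = k y
  · have hs : (fun i => k (Equiv.swap x y i)) = k := by
      funext i
      rw [Equiv.swap_apply_def]
      split_ifs with h1 h2
      · rw [h1, hk]
      · rw [h2, hk]
      · rfl
    have h1 : T * e k = e k * T * e k :=
      hleft.trans
        (Finset.sum_eq_single k (fun l _ h => hzero k l h (by rwa [hs])) (by simp))
    have h2 : e k * T = e k * T * e k := by
      refine (hright k).trans (Finset.sum_eq_single k
        (fun l _ h => hzero l k h.symm fun h' => h ?_) (by simp))
      rw [hswap h', hs]
    rw [hs, h1, ← h2]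
    simp [hk]
  · set s : Fin n → Fin r := fun i => k (Equiv.swap x y i) with hs
    have hsx : s x = k y := by simp [hs]
    have hsy : s y = k x := by simp [hs]
    have hsk : s ≠ k := fun h => hk (by rw [← hsy, h])
    have h1 : T * e k = e s * T * e k + e k * T * e k := by
      rw [hleft]
      exact Finset.sum_eq_add s k hsk (fun l _ h => hzero k l h.2 h.1)
        (fun h => absurd (Finset.mem_univ _) h) (fun h => absurd (Finset.mem_univ _) h)
    have h2 : e s * T = e s * T * e k + e s * T * e s := by
      refine (hright s).trans (Finset.sum_eq_add k s hsk.symm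
        (fun l _ h => hzero l s h.2.symm fun h' => h.1 ?_)
        (fun h => absurd (Finset.mem_univ _) h) (fun h => absurd (Finset.mem_univ _) h))
      rw [hswap h']
      simp [hs]
    rw [h2, h1, hdiag k hk, hdiag s (by rw [hsx, hsy]; exact Ne.symm hk), hsx, hsy, smul_sub]
    abel

end Weight

lemma isUnit_sub_of_prod_eq_unit {R : Type*} [CommRing R] {r : ℕ} {u : Fin r → R} {Δ : Rˣ}
    (hΔ : (Δ : R) = ∏ i : Fin r, ∏ j ∈ Finset.univ.filter (fun j => j < i), (u i - u j))
    (c c' : Fin r) (h : c ≠ c') : IsUnit (u c - u c') := by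
  have key : ∀ i j : Fin r, j < i → IsUnit (u i - u j) := by
    intro i j hij
    refine isUnit_of_dvd_unit ?_ Δ.isUnit
    rw [hΔ]
    exact (Finset.dvd_prod_of_mem (fun j => u i - u j) (by simpa using hij)).trans
      (Finset.dvd_prod_of_mem
        (fun i => ∏ j ∈ Finset.univ.filter (fun j => j < i), (u i - u j)) (Finset.mem_univ i))
  rcases lt_or_gt_of_ne h with h | h
  · rw [← neg_sub]
    exact (key _ _ h).neg
  · exact key _ _ h

section BPoly

variable (R : Type*) [CommRing R] (r : ℕ) (u : Fin r → R)

lemma bpoly_eq (c : Fin r) :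
    bpoly R r u c = (∏ j ∈ Finset.univ.filter (fun j => j ≠ c), Ring.inverse (u c - u j)) •
      ∏ j ∈ Finset.univ.filter (fun j => j ≠ c), (X - C (u j)) := by
  rw [bpoly, Finset.prod_smul]

lemma X_sub_C_mul_bpoly (c : Fin r) :
    (X - C (u c)) * bpoly R r u c =
      (∏ j ∈ Finset.univ.filter (fun j => j ≠ c), Ring.inverse (u c - u j)) •
        ∏ j, (X - C (u j)) := by
  rw [bpoly_eq, mul_smul_comm, Finset.filter_ne', Finset.mul_prod_erase _ (fun j => X - C (u j)) (Finset.mem_univ c)]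

lemma eval_bpoly (hu : ∀ c c', c ≠ c' → IsUnit (u c - u c')) (c c' : Fin r) :
    (bpoly R r u c).eval (u c') = if c = c' then 1 else 0 := by
  rw [bpoly, eval_prod]
  split_ifs with h
  · subst h
    refine Finset.prod_eq_one fun j hj => ?_
    simpa using Ring.inverse_mul_cancel _ (hu c j (Ne.symm (by simpa using hj)))
  · exact Finset.prod_eq_zero (i := c') (by simpa using Ne.symm h) (by simp)

lemma degree_bpoly_lt (c : Fin r) : (bpoly R r u c).degree < r := by
  nontriviality R
  rw [bpoly_eq]
  refine (degree_smul_le _ _).trans_lt ((degree_prod_le _ _).trans_lt ?_)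
  simp only [degree_X_sub_C, Finset.sum_const, Finset.filter_ne', nsmul_eq_mul, mul_one,
    Finset.card_erase_of_mem (Finset.mem_univ c), Finset.card_univ, Fintype.card_fin]
  exact_mod_cast Nat.sub_lt c.pos one_pos

lemma sum_bpoly [IsDomain R] (hr : 1 ≤ r) (hu : ∀ c c', c ≠ c' → IsUnit (u c - u c')) :
    ∑ c, bpoly R r u c = 1 := by
  have hinj : Function.Injective u := by
    intro c c' h
    by_contra hne
    exact (hu c c' hne).ne_zero (sub_eq_zero.2 h)
  refine eq_of_degrees_lt_of_eval_index_eq Finset.univ (v := u) hinj.injOn ?_ ?_ ?_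
  · rw [Finset.card_univ, Fintype.card_fin]
    refine (degree_sum_le _ _).trans_lt ((Finset.sup_lt_iff ?_).2 fun c _ => degree_bpoly_lt R r u c)
    exact WithBot.bot_lt_coe r
  · rw [Finset.card_univ, Fintype.card_fin, degree_one]
    exact_mod_cast hr
  · intro c' _
    simp [eval_finsetSum, eval_bpoly R r u hu]

end BPoly

section Hecke

variable (R : Type*) [CommRing R] (n r : ℕ) (q Δ : Rˣ) (u : Fin r → R) (F : Fin r → R[X])

lemma tt_commute (i j : Fin n) : Commute (tt R n r q Δ u F i) (tt R n r q Δ u F j) := by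
  have h := RingQuot.mkAlgHom_rel R (Rel.tcomm (q := q) (Δ := Δ) (u := u) (F := F) i j)
  simpa [tt, pim, Commute, SemiconjBy] using h

lemma aeval_tt (i : Fin n) (P : R[X]) :
    aeval (tt R n r q Δ u F i) P = pim R n r q Δ u F (aeval (tf R n i) P) := by
  rw [tt, aeval_algHom_apply]

lemma tt_commute_aeval (i j : Fin n) (P : R[X]) :
    Commute (tt R n r q Δ u F i) (aeval (tt R n r q Δ u F j) P) := by
  induction P using Polynomial.induction_on' with
  | add P Q hP hQ => simpa using hP.add_right hQ
  | monomial m a =>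
    rw [aeval_monomial]
    exact Commute.mul_right (Algebra.commutes a _).symm ((tt_commute R n r q Δ u F i j).pow_right m)

lemma tt_mul_aeval_bpoly (i : Fin n) (c : Fin r) :
    tt R n r q Δ u F i * aeval (tt R n r q Δ u F i) (bpoly R r u c) =
      u c • aeval (tt R n r q Δ u F i) (bpoly R r u c) := by
  have h0 : aeval (tt R n r q Δ u F i) (∏ c : Fin r, (X - C (u c))) = 0 := by
    have h := RingQuot.mkAlgHom_rel R (Rel.tord (q := q) (Δ := Δ) (u := u) (F := F) i)
    rw [aeval_tt, pim, h, map_zero]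
  have h := congrArg (aeval (tt R n r q Δ u F i)) (X_sub_C_mul_bpoly R r u c)
  rwa [map_smul, h0, smul_zero, map_mul, map_sub, aeval_X, aeval_C, sub_mul, ← Algebra.smul_def,
    sub_eq_zero] at h

lemma tt_mul_b (i : Fin n) (k : Fin n → Fin r) :
    tt R n r q Δ u F i * b R n r q Δ u F k = u (k i) • b R n r q Δ u F k := by
  refine mul_list_prod_eq_smul (fun a ha => ?_) ((List.mem_ofFn' _ _).2 ⟨i, rfl⟩)
    (tt_mul_aeval_bpoly R n r q Δ u F i (k i))
  obtain ⟨j, rfl⟩ := (List.mem_ofFn' _ _).1 ha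
  exact tt_commute_aeval R n r q Δ u F i j _

lemma b_mul_tt (i : Fin n) (k : Fin n → Fin r) :
    b R n r q Δ u F k * tt R n r q Δ u F i = u (k i) • b R n r q Δ u F k := by
  rw [← tt_mul_b]
  refine (Commute.list_prod_right _ _ fun a ha => ?_).symm
  obtain ⟨j, rfl⟩ := (List.mem_ofFn' _ _).1 ha
  exact tt_commute_aeval R n r q Δ u F i j _

lemma sum_b [IsDomain R] (hr : 1 ≤ r) (hu : ∀ c c', c ≠ c' → IsUnit (u c - u c')) :
    ∑ k, b R n r q Δ u F k = 1 := by
  simp only [b]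
  rw [sum_list_prod_ofFn n fun i c => aeval (tt R n r q Δ u F i) (bpoly R r u c)]
  simp [← map_sum, sum_bpoly R r u hr hu]

lemma TT_mul_tt (p : Fin (n - 1)) (i : Fin n) (h1 : i ≠ lo n p) (h2 : i ≠ hi n p) :
    TT R n r q Δ u F p * tt R n r q Δ u F i = tt R n r q Δ u F i * TT R n r q Δ u F p := by
  have h := RingQuot.mkAlgHom_rel R (Rel.Tt (q := q) (Δ := Δ) (u := u) (F := F) p i h1 h2)
  simpa [TT, tt, pim] using h

lemma TT_mul_tt_hi (p : Fin (n - 1)) :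
    TT R n r q Δ u F p * tt R n r q Δ u F (hi n p) =
      tt R n r q Δ u F (lo n p) * TT R n r q Δ u F p +
        pim R n r q Δ u F (Bel R n r q Δ u F p) := by
  have h := RingQuot.mkAlgHom_rel R (Rel.Thi (q := q) (Δ := Δ) (u := u) (F := F) p)
  rwa [map_mul, map_add, map_mul] at h

lemma TT_mul_tt_lo (p : Fin (n - 1)) :
    TT R n r q Δ u F p * tt R n r q Δ u F (lo n p) =
      tt R n r q Δ u F (hi n p) * TT R n r q Δ u F p -
        pim R n r q Δ u F (Bel R n r q Δ u F p) := by
  have h := RingQuot.mkAlgHom_rel R (Rel.Tlo (q := q) (Δ := Δ) (u := u) (F := F) p)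
  rwa [map_mul, map_sub, map_mul] at h

lemma Bel_mul_b
    (hFeval : ∀ c c' : Fin r, (F c).eval (u c') = if c' = c then (Δ : R) else 0)
    (p : Fin (n - 1)) (k : Fin n → Fin r) :
    pim R n r q Δ u F (Bel R n r q Δ u F p) * b R n r q Δ u F k =
      (if k (lo n p) < k (hi n p) then
        (u (k (hi n p)) - u (k (lo n p))) * ((q : R) - ((q⁻¹ : Rˣ) : R)) else 0) •
        b R n r q Δ u F k := by
  have hact : ∀ i c, aeval (tt R n r q Δ u F i) (F c) * b R n r q Δ u F k =
      (if k i = c then (Δ : R) else 0) • b R n r q Δ u F k := fun i c => by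
    rw [aeval_mul_eq_eval_smul (tt_mul_b R n r q Δ u F i k), hFeval]
  simp only [Bel, map_sum, map_smul, map_mul, ← aeval_tt, Finset.sum_mul, smul_mul_assoc,
    mul_assoc, hact, mul_smul_comm, smul_smul, ← Finset.sum_smul]
  congr 1
  rw [Finset.sum_eq_single (k (hi n p))]
  · rw [Finset.sum_filter]
    rw [Finset.sum_eq_single (k (lo n p))]
    · have hΔ : ((Δ⁻¹ : Rˣ) : R) * Δ = 1 := Δ.inv_mul
      simp only [if_true]
      split_ifs
      · linear_combination (u (k (hi n p)) - u (k (lo n p))) * ((q : R) - ((q⁻¹ : Rˣ) : R)) *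
          (((Δ⁻¹ : Rˣ) : R) * Δ + 1) * hΔ
      · rfl
    · intro c _ hc
      simp [hc.symm]
    · simp
  · intro c _ hc
    simp [hc.symm]
  · simp

end Hecke

end MAK

/-- Lemma 2.3 (relation of `T_p` with the basis `b`). -/
theorem statement1
    (R : Type*) [CommRing R] [IsDomain R] (n r : ℕ) (hn : 1 ≤ n) (hr : 1 ≤ r)
    (q Δ : Rˣ) (u : Fin r → R) (F : Fin r → R[X])
    (hΔ : (Δ : R) = ∏ i : Fin r, ∏ j ∈ Finset.univ.filter (fun j => j < i), (u i - u j))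
    (hFdeg : ∀ c : Fin r, (F c).degree = ((r - 1 : ℕ) : WithBot ℕ))
    (hFeval : ∀ c c' : Fin r, (F c).eval (u c') = if c' = c then (Δ : R) else 0)
    (p : Fin (n - 1)) (k : Fin n → Fin r) :
    TT R n r q Δ u F p * b R n r q Δ u F k -
        b R n r q Δ u F (fun i => k (Equiv.swap (lo n p) (hi n p) i)) * TT R n r q Δ u F p =
      ((q : R) - ((q⁻¹ : Rˣ) : R)) •
        ((if k (lo n p) < k (hi n p) then b R n r q Δ u F k else 0) -
          (if k (hi n p) < k (lo n p) then
            b R n r q Δ u F (fun i => k (Equiv.swap (lo n p) (hi n p) i)) else 0)) := by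
  have hu : ∀ c c', c ≠ c' → IsUnit (u c - u c') := isUnit_sub_of_prod_eq_unit hΔ
  exact mul_weight_sub_weight_mul hu (fun k i => tt_mul_b R n r q Δ u F i k)
    (fun k i => b_mul_tt R n r q Δ u F i k) (sum_b R n r q Δ u F hr hu)
    (TT_mul_tt R n r q Δ u F p) (TT_mul_tt_lo R n r q Δ u F p) (TT_mul_tt_hi R n r q Δ u F p)
    (Bel_mul_b R n r q Δ u F hFeval p) k
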